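/- arXiv:1611.01488 — 4 statements merged into one kernel-verified Lean document; each statement's English description precedes it below -/
import Mathlib

section
/- Let $k$ be a field and let $A$ be a (possibly non-unital, possibly non-commutative) $k$-algebra of $k$-dimension at least two. If $A$ possesses a $k$-basis that is closed under multiplication, then $A$ has a two-sided ideal of $k$-codimension one (namely, the kernel of the coefficient-sum functional associated to that basis, which is a nonzero linear multiplicative map onto $k$). -/
/-- A linear functional that takes the value `1` on a multiplicatively closed spanning set
is multiplicative. -/
theorem LinearMap.map_mul_of_eq_one_on_span {k A : Type*} [CommSemiring k]
    [NonUnitalNonAssocSemiring A] [Module k A] [SMulCommClass k A A] [IsScalarTower k A A]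
    {H : Set A} (hspan : Submodule.span k H = ⊤) (hmul : ∀ x ∈ H, ∀ y ∈ H, x * y ∈ H)
    (f : A →ₗ[k] k) (hf : ∀ x ∈ H, f x = 1) (x y : A) : f (x * y) = f x * f y := by
  have h : (LinearMap.mul k A).compr₂ f = (LinearMap.mul k k).compl₁₂ f f := by
    refine LinearMap.ext_on hspan fun x hx => LinearMap.ext_on hspan fun y hy => ?_
    simp [hf _ hx, hf _ hy, hf _ (hmul x hx y hy)]
  simpa using LinearMap.congr_fun₂ h x y

/-- The kernel of a nonzero linear functional has codimension one. -/
theorem LinearMap.rank_quotient_ker_eq_one {k V : Type*} [Field k] [AddCommGroup V] [Module k V]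
    {f : V →ₗ[k] k} (hf : f ≠ 0) : Module.rank k (V ⧸ LinearMap.ker f) = 1 := by
  rw [Module.rank_eq_one_iff_finrank_eq_one,
    (f.quotKerEquivOfSurjective (LinearMap.surjective hf)).finrank_eq, Module.finrank_self]

/-- If a (possibly non-unital, non-commutative) `k`-algebra `A` of `k`-dimension at least
two has a `k`-basis closed under multiplication, then `A` has a two-sided ideal
(a linear subspace absorbing multiplication on both sides) of `k`-codimension one. -/
theorem exists_codim_one_ideal_of_multiplicatively_closed_basis
    (k A : Type*) [Field k] [NonUnitalRing A] [Module k A]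
    [SMulCommClass k A A] [IsScalarTower k A A]
    (hdim : 2 ≤ Module.rank k A)
    (hbasis : ∃ H : Set A,
        (LinearIndependent k ((↑) : H → A) ∧ Submodule.span k H = ⊤) ∧
        ∀ x ∈ H, ∀ y ∈ H, x * y ∈ H) :
    ∃ I : Submodule k A,
      (∀ a ∈ I, ∀ x : A, x * a ∈ I ∧ a * x ∈ I) ∧
      Module.rank k (A ⧸ I) = 1 := by
  obtain ⟨H, ⟨hli, hspan⟩, hmul⟩ := hbasis
  let b : Module.Basis H k A := .mk hli (by simp [hspan])
  let f : A →ₗ[k] k := b.constr k fun _ => 1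
  have hf : ∀ x ∈ H, f x = 1 := fun x hx => by
    simpa [b] using b.constr_basis k (fun _ => (1 : k)) ⟨x, hx⟩
  have hf_mul := f.map_mul_of_eq_one_on_span hspan hmul hf
  refine ⟨LinearMap.ker f, fun a ha x => ?_, LinearMap.rank_quotient_ker_eq_one fun hf0 => ?_⟩
  · rw [LinearMap.mem_ker] at ha
    simp [hf_mul, ha]
  · have hH : H = ∅ := Set.eq_empty_of_forall_notMem fun x hx => by
      simpa [hf0] using hf x hx
    have hrank : Module.rank k A = 0 := by
      rw [← rank_top, ← hspan, hH, Submodule.span_empty, rank_bot]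
    simp [hrank] at hdim
end

section
/- (Mabry's theorem) Let $k_1$ be a proper subfield of a field $k_2$. Then no basis of $k_2$, regarded as a vector space over $k_1$, is closed under multiplication; that is, there is no $k_1$-basis $H$ of $k_2$ with $x \cdot y \in H$ for all $x, y \in H$. -/
/-- If a basis of an algebra is closed under multiplication, then the linear form taking the
value `1` on every basis vector is multiplicative. -/
theorem Module.Basis.constr_one_mul {ι K A : Type*} [CommRing K] [CommRing A] [Algebra K A]
    (b : Module.Basis ι K A) (hb : ∀ i j, ∃ l, b i * b j = b l) (x y : A) :
    b.constr K (fun _ => (1 : K)) (x * y) =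
      b.constr K (fun _ => (1 : K)) x * b.constr K (fun _ => (1 : K)) y := by
  set φ := b.constr K (fun _ => (1 : K)) with hφ
  have h : (LinearMap.mul K A).compr₂ φ = (LinearMap.mul K K).compl₁₂ φ φ := by
    refine LinearMap.ext_basis b b fun i j => ?_
    obtain ⟨l, hl⟩ := hb i j
    simp [hl, hφ, Module.Basis.constr_basis]
  exact LinearMap.congr_fun₂ h x y

/-- A basis of a field extension that is closed under multiplication has at most one element. -/
theorem Module.Basis.subsingleton_of_mul_closed {ι K L : Type*} [Field K] [Field L] [Algebra K L]
    (b : Module.Basis ι K L) (hb : ∀ i j, ∃ l, b i * b j = b l) : Subsingleton ι := by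
  refine ⟨fun i j => b.injective ?_⟩
  by_contra hij
  have hmul := b.constr_one_mul hb (b i - b j) ((b i - b j)⁻¹ * b i)
  rw [mul_inv_cancel_left₀ (sub_ne_zero.mpr hij)] at hmul
  simp [Module.Basis.constr_basis] at hmul

/-- Mabry's theorem: if `k₁` is a proper subfield of a field `k₂`, then no basis of `k₂`
as a `k₁`-vector space is closed under multiplication. -/
theorem mabry (k₂ : Type*) [Field k₂] (k₁ : Subfield k₂) (hk : k₁ ≠ ⊤) :
    ¬ ∃ H : Set k₂,
        (LinearIndependent k₁ ((↑) : H → k₂) ∧ Submodule.span k₁ H = ⊤) ∧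
        ∀ x ∈ H, ∀ y ∈ H, x * y ∈ H := by
  rintro ⟨H, ⟨hli, hspan⟩, hmul⟩
  let b : Module.Basis H k₁ k₂ := Module.Basis.mk hli (by simp [hspan])
  have hb : ∀ i, b i = i := fun i => Module.Basis.mk_apply hli _ i
  have hsub : Subsingleton H := b.subsingleton_of_mul_closed fun i j =>
    ⟨⟨i * j, hmul _ i.2 _ j.2⟩, by simp [hb]⟩
  have hone : ∀ h ∈ H, h = 1 := fun h hh => by
    have hsq : h * h = h :=
      congrArg Subtype.val (Subsingleton.elim (⟨h * h, hmul h hh h hh⟩ : H) ⟨h, hh⟩)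
    exact mul_left_cancel₀ (hli.ne_zero ⟨h, hh⟩) (hsq.trans (mul_one h).symm)
  refine hk (eq_top_iff.mpr fun x _ => ?_)
  have hx : x ∈ Submodule.span k₁ ({1} : Set k₂) :=
    Submodule.span_mono hone (hspan ▸ Submodule.mem_top)
  obtain ⟨a, rfl⟩ := Submodule.mem_span_singleton.mp hx
  simp [Subfield.smul_def]
end

section
/- Let $k$ be a field and let $A$ be a simple $k$-algebra (one whose only two-sided ideals are $\{0\}$ and $A$) of $k$-dimension at least two. Then no basis of $A$ as a $k$-vector space is closed under multiplication. -/
/-- A linear form taking the value `1` on a spanning set closed under multiplication is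
multiplicative. -/
theorem LinearMap.map_mul_of_eq_one_on_spanning_set
    {k A : Type*} [Field k] [Ring A] [Algebra k A] {H : Set A} (f : A →ₗ[k] k)
    (hspan : Submodule.span k H = ⊤) (hmul : ∀ x ∈ H, ∀ y ∈ H, x * y ∈ H)
    (hf : ∀ x ∈ H, f x = 1) (x y : A) : f (x * y) = f x * f y := by
  have key : (LinearMap.mul k A).compr₂ f = (LinearMap.mul k k).compl₁₂ f f := by
    refine LinearMap.ext_on hspan fun u hu => LinearMap.ext_on hspan fun v hv => ?_
    simp [hf u hu, hf v hv, hf _ (hmul u hu v hv)]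
  simpa using LinearMap.congr_fun₂ key x y

/-- A simple `k`-algebra (only two-sided ideals are `⊥` and `⊤`) of `k`-dimension at
least two has no `k`-basis closed under multiplication. -/
theorem simple_algebra_no_multiplicatively_closed_basis
    (k A : Type*) [Field k] [Ring A] [Algebra k A]
    (hsimple : ∀ I : Submodule k A,
      (∀ a ∈ I, ∀ x : A, x * a ∈ I ∧ a * x ∈ I) → I = ⊥ ∨ I = ⊤)
    (hdim : 2 ≤ Module.rank k A) :
    ¬ ∃ H : Set A,
        (LinearIndependent k ((↑) : H → A) ∧ Submodule.span k H = ⊤) ∧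
        ∀ x ∈ H, ∀ y ∈ H, x * y ∈ H := by
  rintro ⟨H, ⟨hli, hspan⟩, hmul⟩
  let b : Module.Basis H k A := Module.Basis.mk hli (by simp [hspan])
  let f : A →ₗ[k] k := b.constr k fun _ => 1
  have hf : ∀ x ∈ H, f x = 1 := fun x hx => by
    simpa [b, f] using b.constr_basis k (fun _ => (1 : k)) ⟨x, hx⟩
  have hfmul := f.map_mul_of_eq_one_on_spanning_set hspan hmul hf
  rcases hsimple (LinearMap.ker f) fun a ha x => by
    simp [hfmul, LinearMap.mem_ker.mp ha] with hker | hker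
  · have hle := LinearMap.lift_rank_le_of_injective f (LinearMap.ker_eq_bot.mp hker)
    rw [Module.rank_self, Cardinal.lift_one, Cardinal.lift_le_one_iff] at hle
    exact absurd (hdim.trans hle) (by norm_num)
  · have hempty : H = ∅ := Set.eq_empty_of_forall_notMem fun x hx => by
      have hx0 : f x = 0 := by rw [LinearMap.ker_eq_top.mp hker, LinearMap.zero_apply]
      exact one_ne_zero ((hf x hx).symm.trans hx0)
    have hrank : Module.rank k A = 0 := by
      rw [← rank_top, ← hspan, hempty, Submodule.span_empty, rank_bot]
    rw [hrank] at hdim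
    exact absurd hdim (by norm_num)
end

section
/- Let $k$ be a field and let $n \geq 2$ be a natural number. Then the $k$-algebra $M_n(k)$ of all $n \times n$ matrices over $k$ has no basis (as a $k$-vector space) that is closed under matrix multiplication. -/
/-- A multiplicative linear functional on a matrix algebra of size at least two vanishes. -/
theorem Matrix.linearMap_eq_zero_of_map_mul {k ι : Type*} [Field k] [Fintype ι] [DecidableEq ι]
    [Nontrivial ι] (φ : Matrix ι ι k →ₗ[k] k) (hφ : ∀ x y, φ (x * y) = φ x * φ y) : φ = 0 := by
  have off_diag : ∀ (i j : ι) (c : k), i ≠ j → φ (Matrix.single i j c) = 0 := by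
    intro i j c hij
    have h := hφ (Matrix.single i j c) (Matrix.single i j c)
    rw [Matrix.single_mul_single_of_ne _ _ _ _ hij.symm, map_zero] at h
    exact mul_self_eq_zero.mp h.symm
  ext x
  induction x using Matrix.induction_on' with
  | h_zero => simp
  | h_add p q hp hq => simp_all
  | h_std_basis i j c =>
    by_cases hij : i = j
    · subst hij
      obtain ⟨l, hl⟩ := exists_ne i
      have h := hφ (Matrix.single i l c) (Matrix.single l i 1)
      rw [Matrix.single_mul_single_same, mul_one, off_diag i l c hl.symm, zero_mul] at h
      exact h
    · exact off_diag i j c hij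

/-- The linear functional sending every element of a multiplicatively closed basis to `1` is
multiplicative. -/
theorem Module.Basis.constr_one_map_mul {k A ι : Type*} [Field k] [Ring A] [Algebra k A]
    (b : Module.Basis ι k A) (hb : ∀ i j, ∃ l, b i * b j = b l) (x y : A) :
    b.constr k (fun _ => (1 : k)) (x * y) =
      b.constr k (fun _ => (1 : k)) x * b.constr k (fun _ => (1 : k)) y := by
  set φ := b.constr k (fun _ => (1 : k)) with hφ
  have key : (LinearMap.mul k A).compr₂ φ = (LinearMap.mul k k).compl₁₂ φ φ := by
    refine b.ext fun i => b.ext fun j => ?_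
    obtain ⟨l, hl⟩ := hb i j
    simp [hl, hφ, Module.Basis.constr_basis]
  exact LinearMap.congr_fun₂ key x y

/-- For `n ≥ 2`, the matrix algebra `Mₙ(k)` has no `k`-basis closed under matrix
multiplication. -/
theorem matrix_algebra_no_multiplicatively_closed_basis
    (k : Type*) [Field k] (n : ℕ) (hn : 2 ≤ n) :
    ¬ ∃ H : Set (Matrix (Fin n) (Fin n) k),
        (LinearIndependent k ((↑) : H → Matrix (Fin n) (Fin n) k) ∧
          Submodule.span k H = ⊤) ∧
        ∀ x ∈ H, ∀ y ∈ H, x * y ∈ H := by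
  rintro ⟨H, ⟨hli, hspan⟩, hmul⟩
  have : Nontrivial (Fin n) := Fin.nontrivial_iff_two_le.mpr hn
  let b := Module.Basis.mk hli (by simp [hspan])
  have hb : ∀ i j, ∃ l, b i * b j = b l := fun i j =>
    ⟨⟨i * j, hmul i i.2 j j.2⟩, by simp [b]⟩
  have hzero := Matrix.linearMap_eq_zero_of_map_mul _ (b.constr_one_map_mul hb)
  obtain ⟨i⟩ := b.index_nonempty
  simpa using (b.constr_basis k (fun _ => (1 : k)) i).symm.trans (LinearMap.congr_fun hzero (b i))
end
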